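/- Let k ∈ ℕ, and suppose the Riemannian metrics g on Ω ⊆ V and g′ on Ω′ ⊆ V′ admit Levi-Civita connection forms of class C^k. Then every C² isometry F : Ω → Ω′ between g and g′ is automatically C^{k+2}. -/

import Mathlib

open scoped Topology

noncomputable section

/-- A Riemannian metric on `Ω`: a family of symmetric positive definite continuous bilinear
forms. -/
def IsRiemannianMetric {V : Type*} [NormedAddCommGroup V] [NormedSpace ℝ V]
    (Ω : Set V) (g : V → V →L[ℝ] V →L[ℝ] ℝ) : Prop :=
  (∀ v ∈ Ω, ∀ ξ η : V, g v ξ η = g v η ξ) ∧ ∀ v ∈ Ω, ∀ ξ : V, ξ ≠ 0 → 0 < g v ξ ξ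

/-- `A` is a Levi-Civita connection form for `g` on `Ω` (torsion-free and compatible). -/
def IsLeviCivita {V : Type*} [NormedAddCommGroup V] [NormedSpace ℝ V]
    (Ω : Set V) (g : V → V →L[ℝ] V →L[ℝ] ℝ) (A : V → V →L[ℝ] V →L[ℝ] V) : Prop :=
  (∀ v ∈ Ω, ∀ ξ η : V, A v ξ η = A v η ξ) ∧
  ∀ v ∈ Ω, ∀ η ζ : V, HasFDerivAt (fun w => g w η ζ)
    (((g v).flip ζ).comp ((A v).flip η) + ((g v) η).comp ((A v).flip ζ)) v

section WeaklyDifferentiableForms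

open Set Filter

variable {W : Type*} [NormedAddCommGroup W] [NormedSpace ℝ W]
  {b : ℝ → W →L[ℝ] W →L[ℝ] ℝ} {c : ℝ} {S : Set ℝ}

/-- The path `b` of bilinear forms is weakly differentiable on `S`, with derivative at `t`
bounded by `c * ‖b t‖`. -/
def HasWeakDerivBound (b : ℝ → W →L[ℝ] W →L[ℝ] ℝ) (c : ℝ) (S : Set ℝ) : Prop :=
  ∀ t ∈ S, ∀ η ζ : W, ∃ d : ℝ,
    HasDerivWithinAt (fun s => b s η ζ) d S t ∧ |d| ≤ c * ‖b t‖ * ‖η‖ * ‖ζ‖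

theorem HasWeakDerivBound.mono {T : Set ℝ} (h : HasWeakDerivBound b c S) (hT : T ⊆ S) :
    HasWeakDerivBound b c T := fun t ht η ζ =>
  let ⟨d, hd, hb⟩ := h t (hT ht) η ζ
  ⟨d, hd.mono hT, hb⟩

theorem HasWeakDerivBound.norm_sub_le (h : HasWeakDerivBound b c S) (hS : Convex ℝ S)
    (hc : 0 ≤ c) {M : ℝ} (hM : ∀ t ∈ S, ‖b t‖ ≤ M) {s t : ℝ} (hs : s ∈ S) (ht : t ∈ S) :
    ‖b s - b t‖ ≤ c * M * |s - t| := by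
  have hM0 : 0 ≤ M := (norm_nonneg (b s)).trans (hM s hs)
  refine ContinuousLinearMap.opNorm_le_bound₂ _ (by positivity) fun η ζ => ?_
  have hex : ∀ t, ∃ d : ℝ, t ∈ S →
      HasDerivWithinAt (fun s => b s η ζ) d S t ∧ |d| ≤ c * ‖b t‖ * ‖η‖ * ‖ζ‖ := fun t => by
    by_cases ht : t ∈ S
    · obtain ⟨d, hd⟩ := h t ht η ζ
      exact ⟨d, fun _ => hd⟩
    · exact ⟨0, fun h' => absurd h' ht⟩
  choose d hd using hex
  have key := hS.norm_image_sub_le_of_norm_hasDerivWithin_le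
    (f := fun s => b s η ζ) (f' := d) (C := c * M * ‖η‖ * ‖ζ‖) (fun x hx => (hd x hx).1)
    (fun x hx => (hd x hx).2.trans (by gcongr; exact hM x hx)) ht hs
  calc ‖(b s - b t) η ζ‖ = ‖b s η ζ - b t η ζ‖ := by simp
    _ ≤ c * M * ‖η‖ * ‖ζ‖ * ‖s - t‖ := key
    _ = c * M * |s - t| * ‖η‖ * ‖ζ‖ := by rw [Real.norm_eq_abs]; ring

theorem HasWeakDerivBound.norm_le_two_mul_of_bounded (h : HasWeakDerivBound b c S)
    (hS : Convex ℝ S) (hc : 0 ≤ c) (hlen : ∀ s ∈ S, ∀ t ∈ S, c * |s - t| ≤ 1 / 2)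
    {M : ℝ} (hM : ∀ t ∈ S, ‖b t‖ ≤ M) {s t : ℝ} (hs : s ∈ S) (ht : t ∈ S) :
    ‖b s‖ ≤ 2 * ‖b t‖ := by
  set N := sSup ((fun t => ‖b t‖) '' S) with hN
  have hbdd : BddAbove ((fun t => ‖b t‖) '' S) := ⟨M, by rintro _ ⟨x, hx, rfl⟩; exact hM x hx⟩
  have hle : ∀ x ∈ S, ‖b x‖ ≤ N := fun x hx => le_csSup hbdd ⟨x, hx, rfl⟩
  have hN0 : 0 ≤ N := (norm_nonneg (b s)).trans (hle s hs)
  have : N ≤ ‖b t‖ + N / 2 := by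
    refine csSup_le ⟨_, s, hs, rfl⟩ ?_
    rintro _ ⟨x, hx, rfl⟩
    have h1 := h.norm_sub_le hS hc hle hx ht
    have h2 : c * N * |x - t| ≤ N / 2 := by nlinarith [hlen x hx t ht]
    have h3 := norm_le_norm_add_norm_sub' (b x) (b t)
    dsimp only
    linarith
  linarith [hle s hs]

/-- Local boundedness of the path `b` at `t`, within the unit interval. -/
def LocallyBoundedAt (b : ℝ → W →L[ℝ] W →L[ℝ] ℝ) (t : ℝ) : Prop :=
  ∃ M : ℝ, ∀ᶠ s in 𝓝[Icc 0 1] t, ‖b s‖ ≤ M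

theorem isClosed_setOf_not_locallyBoundedAt (b : ℝ → W →L[ℝ] W →L[ℝ] ℝ) :
    IsClosed {t | ¬ LocallyBoundedAt b t} := by
  rw [← isOpen_compl_iff, isOpen_iff_mem_nhds]
  intro t ht
  simp only [mem_compl_iff, mem_ofPred_eq, not_not] at ht
  obtain ⟨M, hM⟩ := ht
  filter_upwards [eventually_nhds_nhdsWithin.2 hM] with s hs
  simp only [mem_compl_iff, mem_ofPred_eq, not_not]
  exact ⟨M, hs⟩

theorem mem_Icc_of_not_locallyBoundedAt {t : ℝ} (ht : ¬ LocallyBoundedAt b t) :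
    t ∈ Icc (0 : ℝ) 1 := by
  by_contra h
  refine ht ⟨0, ?_⟩
  have : t ∉ closure (Icc (0 : ℝ) 1) := by rwa [isClosed_Icc.closure_eq]
  rw [notMem_closure_iff_nhdsWithin_eq_bot.1 this]
  exact eventually_bot

theorem exists_bound_of_locallyBoundedAt {K : Set ℝ} (hK : IsCompact K)
    (hK1 : K ⊆ Icc 0 1) (h : ∀ t ∈ K, LocallyBoundedAt b t) : ∃ M, ∀ t ∈ K, ‖b t‖ ≤ M := by
  refine hK.induction_on (p := fun s => ∃ M, ∀ t ∈ s, ‖b t‖ ≤ M) ⟨0, by simp⟩ ?_ ?_ ?_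
  · rintro s t hst ⟨M, hM⟩
    exact ⟨M, fun x hx => hM x (hst hx)⟩
  · rintro s t ⟨M, hM⟩ ⟨N, hN⟩
    refine ⟨max M N, ?_⟩
    rintro x (hx | hx)
    · exact (hM x hx).trans (le_max_left _ _)
    · exact (hN x hx).trans (le_max_right _ _)
  · intro x hx
    obtain ⟨M, hM⟩ := h x hx
    exact ⟨_, nhdsWithin_mono x hK1 hM, M, fun t ht => ht⟩

theorem HasWeakDerivBound.norm_le_two_mul_of_locallyBoundedAt
    (h : HasWeakDerivBound b c (Icc 0 1)) (hc : 0 ≤ c) (hc2 : c ≤ 1 / 2) {q t : ℝ}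
    (hq : q ∈ Icc (0 : ℝ) 1) (ht : t ∈ Icc (0 : ℝ) 1)
    (hb : ∀ s ∈ uIcc q t, s ≠ q → LocallyBoundedAt b s) : ‖b t‖ ≤ 2 * ‖b q‖ := by
  have hlen : ∀ s ∈ Icc (0 : ℝ) 1, ∀ t ∈ Icc (0 : ℝ) 1, c * |s - t| ≤ 1 / 2 := by
    intro s hs t ht
    have : |s - t| ≤ 1 := abs_le.2 ⟨by linarith [hs.1, ht.2], by linarith [hs.2, ht.1]⟩
    nlinarith [abs_nonneg (s - t)]
  have hsub : uIcc q t ⊆ Icc 0 1 := uIcc_subset_Icc hq ht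
  have hbd : ∀ s ∈ uIcc q t, ‖b s‖ ≤ max (2 * ‖b t‖) ‖b q‖ := by
    intro s hs
    by_cases hsq : s = q
    · rw [hsq]; exact le_max_right _ _
    refine le_max_of_le_left ?_
    have hst : uIcc s t ⊆ uIcc q t := uIcc_subset_uIcc hs right_mem_uIcc
    obtain ⟨M, hM⟩ := exists_bound_of_locallyBoundedAt (b := b) (isCompact_uIcc (a := s) (b := t))
      (hst.trans hsub) fun x hx => hb x (hst hx) (by
        rintro rfl
        rw [mem_uIcc] at hs hx
        grind)
    exact (h.mono (hst.trans hsub)).norm_le_two_mul_of_bounded (convex_uIcc s t) hc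
      (fun x hx y hy => hlen x (hsub (hst hx)) y (hsub (hst hy))) hM left_mem_uIcc right_mem_uIcc
  exact (h.mono hsub).norm_le_two_mul_of_bounded (convex_uIcc q t) hc
    (fun x hx y hy => hlen x (hsub hx) y (hsub hy)) hbd right_mem_uIcc left_mem_uIcc

/-- Baire's theorem replaces the uniform boundedness principle, which is not available because `W`
need not be complete. -/
theorem exists_ball_norm_le_of_weaklyContinuousOn {K : Set ℝ} (hK : IsClosed K)
    (hne : K.Nonempty) (hcont : ∀ η ζ : W, ContinuousOn (fun s => b s η ζ) K) :
    ∃ n : ℕ, ∃ p ∈ K, ∃ ε > 0, ∀ s ∈ K, |s - p| < ε → ‖b s‖ ≤ n := by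
  have : CompleteSpace K := hK.completeSpace_coe
  have : Nonempty K := hne.to_subtype
  have hclosed : ∀ n : ℕ, IsClosed {s : K | ‖b s‖ ≤ n} := fun n => by
    have : {s : K | ‖b s‖ ≤ n} = ⋂ (η : W) (ζ : W), {s : K | ‖b s η ζ‖ ≤ n * ‖η‖ * ‖ζ‖} := by
      ext s
      simp only [mem_ofPred_eq, mem_iInter]
      exact ⟨fun hs η ζ => ((b s).le_opNorm₂ η ζ).trans (by gcongr), fun hs =>
        ContinuousLinearMap.opNorm_le_bound₂ _ n.cast_nonneg hs⟩
    rw [this]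
    exact isClosed_iInter fun η => isClosed_iInter fun ζ =>
      isClosed_le (hcont η ζ).domRestrict.norm continuous_const
  have hunion : ⋃ n : ℕ, {s : K | ‖b s‖ ≤ n} = univ := by
    refine eq_univ_of_forall fun s => mem_iUnion.2 ?_
    obtain ⟨n, hn⟩ := exists_nat_ge ‖b s‖
    exact ⟨n, hn⟩
  obtain ⟨n, p, hp⟩ := nonempty_interior_of_iUnion_of_closed hclosed hunion
  rw [mem_interior_iff_mem_nhds, Metric.mem_nhds_iff] at hp
  obtain ⟨ε, hε, hball⟩ := hp
  refine ⟨n, p, p.2, ε, hε, fun s hs hd => ?_⟩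
  have hmem : (⟨s, hs⟩ : K) ∈ Metric.ball p ε := by
    rwa [Metric.mem_ball, Subtype.dist_eq, Real.dist_eq]
  simpa only [mem_ofPred_eq] using hball hmem

theorem exists_mem_uIcc_forall_notMem {K : Set ℝ} (hK : IsClosed K) {p : ℝ} (hp : p ∈ K)
    (s : ℝ) : ∃ q ∈ K ∩ uIcc p s, ∀ x ∈ uIcc q s, x ≠ q → x ∉ K := by
  have hcomp : IsCompact (K ∩ uIcc p s) := isCompact_uIcc.inter_left hK
  have hne : (K ∩ uIcc p s).Nonempty := ⟨p, hp, left_mem_uIcc⟩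
  rcases le_total p s with hps | hps
  · obtain ⟨q, hq, hmax⟩ := hcomp.exists_isGreatest hne
    refine ⟨q, hq, fun x hx hxq hxK => hxq ?_⟩
    have hxle : x ≤ q := hmax ⟨hxK, uIcc_subset_uIcc hq.2 right_mem_uIcc hx⟩
    have hqs : q ≤ s := (uIcc_of_le hps ▸ hq.2).2
    exact le_antisymm hxle (uIcc_of_le hqs ▸ hx).1
  · obtain ⟨q, hq, hmin⟩ := hcomp.exists_isLeast hne
    refine ⟨q, hq, fun x hx hxq hxK => hxq ?_⟩
    have hqle : q ≤ x := hmin ⟨hxK, uIcc_subset_uIcc hq.2 right_mem_uIcc hx⟩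
    have hsq : s ≤ q := (uIcc_of_ge hps ▸ hq.2).1
    exact le_antisymm (uIcc_of_ge hsq ▸ hx).2 hqle

theorem HasWeakDerivBound.locallyBoundedAt (h : HasWeakDerivBound b c (Icc 0 1))
    (hc : 0 ≤ c) (hc2 : c ≤ 1 / 2) (t : ℝ) : LocallyBoundedAt b t := by
  by_contra ht
  have hKc := isClosed_setOf_not_locallyBoundedAt b
  have hK1 : {t | ¬ LocallyBoundedAt b t} ⊆ Icc 0 1 :=
    fun s hs => mem_Icc_of_not_locallyBoundedAt hs
  have hcont : ∀ η ζ : W, ContinuousOn (fun s => b s η ζ) (Icc 0 1) := fun η ζ s hs =>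
    let ⟨_, hd, _⟩ := h s hs η ζ
    hd.continuousWithinAt
  obtain ⟨n, p, hp, ε, hε, hKn⟩ := exists_ball_norm_le_of_weaklyContinuousOn hKc ⟨t, ht⟩
    fun η ζ => (hcont η ζ).mono hK1
  refine hp ⟨2 * n, ?_⟩
  filter_upwards [self_mem_nhdsWithin, mem_nhdsWithin_of_mem_nhds (Metric.ball_mem_nhds p hε)]
    with s hs hsp
  rw [Metric.mem_ball, Real.dist_eq] at hsp
  obtain ⟨q, ⟨hqK, hq⟩, hqs⟩ := exists_mem_uIcc_forall_notMem hKc hp s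
  have h1 := h.norm_le_two_mul_of_locallyBoundedAt hc hc2 (hK1 hqK) hs
    fun x hx hxq => not_not.1 (hqs x hx hxq)
  have h2 : ‖b q‖ ≤ n := hKn q hqK ((abs_sub_left_of_mem_uIcc hq).trans_lt hsp)
  linarith

theorem HasWeakDerivBound.norm_sub_le_of_le_half (h : HasWeakDerivBound b c (Icc 0 1))
    (hc : 0 ≤ c) (hc2 : c ≤ 1 / 2) : ‖b 1 - b 0‖ ≤ c * (2 * ‖b 0‖) := by
  have h0 : (0 : ℝ) ∈ Icc (0 : ℝ) 1 := by simp
  have h1 : (1 : ℝ) ∈ Icc (0 : ℝ) 1 := by simp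
  simpa using h.norm_sub_le (convex_Icc 0 1) hc (fun t ht =>
    h.norm_le_two_mul_of_locallyBoundedAt hc hc2 h0 ht fun s _ _ => h.locallyBoundedAt hc hc2 s)
    h1 h0

theorem Filter.Tendsto.clm_apply_of_tendsto {X E F : Type*} [NormedAddCommGroup E]
    [NormedSpace ℝ E] [NormedAddCommGroup F] [NormedSpace ℝ F] {l : Filter X}
    {f : X → E →L[ℝ] F} {u : X → E} {L : E →L[ℝ] F} {e : E}
    (hf : Tendsto f l (𝓝 L)) (hu : Tendsto u l (𝓝 e)) :
    Tendsto (fun x => f x (u x)) l (𝓝 (L e)) :=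
  (isBoundedBilinearMap_apply.continuous.tendsto (L, e)).comp (hf.prodMk_nhds hu)

theorem HasDerivAt.bilinear_apply {x y : ℝ → W} {x' y' : W} {d t : ℝ}
    (hb : ContinuousAt b t) (hd : HasDerivAt (fun s => b s (x t) (y t)) d t)
    (hx : HasDerivAt x x' t) (hy : HasDerivAt y y' t) :
    HasDerivAt (fun s => b s (x s) (y s)) (d + b t x' (y t) + b t (x t) y') t := by
  rw [hasDerivAt_iff_tendsto_slope] at hd hx hy ⊢
  have hb' : Tendsto b (𝓝[≠] t) (𝓝 (b t)) := hb.tendsto.mono_left nhdsWithin_le_nhds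
  have hyc : Tendsto y (𝓝[≠] t) (𝓝 (y t)) :=
    (hasDerivAt_iff_tendsto_slope.2 hy).continuousAt.tendsto.mono_left nhdsWithin_le_nhds
  refine ((hd.add ((hb'.clm_apply_of_tendsto hx).clm_apply_of_tendsto hyc)).add
    ((hb'.clm_apply_of_tendsto tendsto_const_nhds).clm_apply_of_tendsto hy)).congr fun s => ?_
  simp only [slope, vsub_eq_sub, map_smul, map_sub, smul_eq_mul, smul_apply,
    sub_apply]
  ring

end WeaklyDifferentiableForms

section LeviCivita

open Set Filter

variable {V V' : Type*} [NormedAddCommGroup V] [NormedSpace ℝ V]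
  [NormedAddCommGroup V'] [NormedSpace ℝ V']

theorem IsLeviCivita.hasDerivAt_comp {Ω : Set V} {g : V → V →L[ℝ] V →L[ℝ] ℝ}
    {A : V → V →L[ℝ] V →L[ℝ] V} (h : IsLeviCivita Ω g A) {γ : ℝ → V} {γ' : V} {t : ℝ}
    (hγ : HasDerivAt γ γ' t) (ht : γ t ∈ Ω) (η ζ : V) :
    HasDerivAt (fun s => g (γ s) η ζ)
      (g (γ t) (A (γ t) γ' η) ζ + g (γ t) η (A (γ t) γ' ζ)) t := by
  simpa [Function.comp_def] using (h.2 (γ t) ht η ζ).comp_hasDerivAt t hγ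

theorem IsLeviCivita.continuousAt {Ω : Set V} (hΩ : IsOpen Ω) {g : V → V →L[ℝ] V →L[ℝ] ℝ}
    {A : V → V →L[ℝ] V →L[ℝ] V} (h : IsLeviCivita Ω g A) (hA : ContinuousOn A Ω)
    {v : V} (hv : v ∈ Ω) : ContinuousAt g v := by
  set a := ‖A v‖ + 1 with ha
  have ha0 : 0 < a := by positivity
  have hnorm : ContinuousAt (fun w => ‖A w‖) v :=
    (continuous_norm (E := V →L[ℝ] V →L[ℝ] V)).continuousAt.comp
      (hA.continuousAt (hΩ.mem_nhds hv))
  have hAv : ∀ᶠ w in 𝓝 v, ‖A w‖ < a := hnorm.eventually_lt_const (by linarith)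
  obtain ⟨r, hr, hball⟩ := Metric.eventually_nhds_iff_ball.1 (hAv.and (hΩ.mem_nhds hv))
  have key : ∀ᶠ w in 𝓝 v, ‖g w - g v‖ ≤ 2 * a * ‖w - v‖ * (2 * ‖g v‖) := by
    filter_upwards [Metric.ball_mem_nhds v hr,
      Metric.ball_mem_nhds v (show 0 < 1 / (4 * a) by positivity)] with w hw hw'
    rw [Metric.mem_ball, dist_eq_norm] at hw'
    have hseg : ∀ t ∈ Icc (0 : ℝ) 1, v + t • (w - v) ∈ Metric.ball v r := fun t ht =>
      (convex_ball v r).add_smul_sub_mem (Metric.mem_ball_self hr) hw ht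
    have hweak : HasWeakDerivBound (fun t : ℝ => g (v + t • (w - v))) (2 * a * ‖w - v‖)
        (Icc 0 1) := by
      intro t ht η ζ
      have hγ : HasDerivAt (fun t : ℝ => v + t • (w - v)) (w - v) t := by
        simpa using ((hasDerivAt_id t).smul_const (w - v)).const_add v
      obtain ⟨hAt, htΩ⟩ := hball _ (hseg t ht)
      refine ⟨_, (h.hasDerivAt_comp hγ htΩ η ζ).hasDerivWithinAt, ?_⟩
      set u := v + t • (w - v)
      have hAle : ∀ ξ, ‖A u (w - v) ξ‖ ≤ a * ‖w - v‖ * ‖ξ‖ := fun ξ =>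
        ((A u).le_opNorm₂ _ _).trans (by gcongr)
      calc |g u (A u (w - v) η) ζ + g u η (A u (w - v) ζ)|
          ≤ ‖g u (A u (w - v) η) ζ‖ + ‖g u η (A u (w - v) ζ)‖ := abs_add_le _ _
        _ ≤ ‖g u‖ * (a * ‖w - v‖ * ‖η‖) * ‖ζ‖ + ‖g u‖ * ‖η‖ * (a * ‖w - v‖ * ‖ζ‖) := by
          refine add_le_add (((g u).le_opNorm₂ _ _).trans ?_) (((g u).le_opNorm₂ _ _).trans ?_)
          · gcongr; exact hAle η
          · gcongr; exact hAle ζ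
        _ = 2 * a * ‖w - v‖ * ‖g u‖ * ‖η‖ * ‖ζ‖ := by ring
    have hle : 2 * a * ‖w - v‖ ≤ 1 / 2 := by
      rw [lt_div_iff₀ (by positivity)] at hw'
      linarith
    simpa using hweak.norm_sub_le_of_le_half (by positivity) hle
  refine (tendsto_iff_norm_sub_tendsto_zero (E := V →L[ℝ] V →L[ℝ] ℝ)).2 ?_
  refine squeeze_zero' (Eventually.of_forall fun w => norm_nonneg (g w - g v)) key ?_
  have : ContinuousAt (fun w => 2 * a * ‖w - v‖ * (2 * ‖g v‖)) v := by fun_prop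
  simpa using this.tendsto

/-- A function of three arguments that is symmetric in the first two and antisymmetric in the last
two vanishes. -/
theorem eq_zero_of_symm_of_antisymm {ι : Type*} {T : ι → ι → ι → ℝ}
    (hs : ∀ x y z, T x y z = T y x z) (ha : ∀ x y z, T x y z = -T x z y) (x y z : ι) :
    T x y z = 0 := by
  linarith [hs x y z, ha y x z, hs y z x, ha z y x, hs z x y, ha x z y]

/-- An isometry satisfies the transformation law of Levi-Civita connection forms. -/
theorem IsLeviCivita.fderiv_fderiv_isometry {Ω : Set V} (hΩ : IsOpen Ω) {Ω' : Set V'}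
    (hΩ' : IsOpen Ω') {g : V → V →L[ℝ] V →L[ℝ] ℝ} (hg : IsRiemannianMetric Ω g)
    {g' : V' → V' →L[ℝ] V' →L[ℝ] ℝ} (hg' : IsRiemannianMetric Ω' g')
    {A : V → V →L[ℝ] V →L[ℝ] V} (hA : IsLeviCivita Ω g A)
    {A' : V' → V' →L[ℝ] V' →L[ℝ] V'} (hA'c : ContinuousOn A' Ω') (hA' : IsLeviCivita Ω' g' A')
    {F : V → V'} (hF : ContDiffOn ℝ 2 F Ω) (hmaps : MapsTo F Ω Ω')
    (hsurj : ∀ v ∈ Ω, Function.Surjective (fderiv ℝ F v))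
    (hiso : ∀ v ∈ Ω, ∀ ξ : V,
      g' (F v) (fderiv ℝ F v ξ) (fderiv ℝ F v ξ) = g v ξ ξ)
    {v : V} (hv : v ∈ Ω) (ζ ξ : V) :
    fderiv ℝ (fderiv ℝ F) v ζ ξ =
      fderiv ℝ F v (A v ζ ξ) - A' (F v) (fderiv ℝ F v ζ) (fderiv ℝ F v ξ) := by
  have hpol : ∀ w ∈ Ω, ∀ ξ η : V,
      g' (F w) (fderiv ℝ F w ξ) (fderiv ℝ F w η) = g w ξ η := by
    intro w hw ξ η
    have h1 := hiso w hw (ξ + η)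
    simp only [map_add, add_apply] at h1
    linarith [hiso w hw ξ, hiso w hw η, hg.1 w hw ξ η,
      hg'.1 (F w) (hmaps hw) (fderiv ℝ F w ξ) (fderiv ℝ F w η)]
  have hFv : ContDiffAt ℝ 2 F v := hF.contDiffAt (hΩ.mem_nhds hv)
  have hFd : HasFDerivAt F (fderiv ℝ F v) v :=
    (hFv.differentiableAt (by norm_num)).hasFDerivAt
  have hDF : HasFDerivAt (fderiv ℝ F) (fderiv ℝ (fderiv ℝ F) v) v :=
    ((hFv.fderiv_right (m := 1) (by norm_num)).differentiableAt (by norm_num)).hasFDerivAt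
  have hderiv : ∀ ζ ξ η : V,
      g' (F v) (A' (F v) (fderiv ℝ F v ζ) (fderiv ℝ F v ξ)) (fderiv ℝ F v η)
        + g' (F v) (fderiv ℝ F v ξ) (A' (F v) (fderiv ℝ F v ζ) (fderiv ℝ F v η))
        + g' (F v) (fderiv ℝ (fderiv ℝ F) v ζ ξ) (fderiv ℝ F v η)
        + g' (F v) (fderiv ℝ F v ξ) (fderiv ℝ (fderiv ℝ F) v ζ η)
      = g v (A v ζ ξ) η + g v ξ (A v ζ η) := by
    intro ζ ξ η
    set γ : ℝ → V := fun t => v + t • ζ with hγdef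
    have hγ0 : γ 0 = v := by simp [hγdef]
    have hγ : HasDerivAt γ ζ 0 := by
      simpa [hγdef] using ((hasDerivAt_id (0 : ℝ)).smul_const ζ).const_add v
    have hFγ : HasDerivAt (fun t => F (γ t)) (fderiv ℝ F v ζ) 0 := by
      rw [← hγ0] at hFd
      simpa [hγ0, Function.comp_def] using hFd.comp_hasDerivAt (0 : ℝ) hγ
    have hDFγ : ∀ ξ, HasDerivAt (fun t => fderiv ℝ F (γ t) ξ)
        (fderiv ℝ (fderiv ℝ F) v ζ ξ) 0 := fun ξ => by
      rw [← hγ0] at hDF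
      simpa [hγ0] using (hDF.comp_hasDerivAt (0 : ℝ) hγ).clm_apply (hasDerivAt_const (0 : ℝ) ξ)
    have hcont : ContinuousAt (fun t => g' (F (γ t))) 0 := by
      refine ContinuousAt.comp (f := fun t => F (γ t)) (g := g') ?_ hFγ.continuousAt
      exact hA'.continuousAt hΩ' hA'c (by rw [hγ0]; exact hmaps hv)
    have hleft := HasDerivAt.bilinear_apply hcont
      (hA'.hasDerivAt_comp hFγ (by rw [hγ0]; exact hmaps hv) _ _) (hDFγ ξ) (hDFγ η)
    have hright := hA.hasDerivAt_comp hγ (by rwa [hγ0]) ξ η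
    have heq : (fun t => g' (F (γ t)) (fderiv ℝ F (γ t) ξ) (fderiv ℝ F (γ t) η))
        =ᶠ[𝓝 0] fun t => g (γ t) ξ η := by
      filter_upwards [hγ.continuousAt.preimage_mem_nhds (hΩ.mem_nhds (by rwa [hγ0]))] with t ht
      exact hpol _ ht ξ η
    simpa only [hγ0] using hleft.unique (hright.congr_of_eventuallyEq heq)
  set S : V → V → V' := fun ζ ξ => fderiv ℝ (fderiv ℝ F) v ζ ξ
    + A' (F v) (fderiv ℝ F v ζ) (fderiv ℝ F v ξ) - fderiv ℝ F v (A v ζ ξ) with hS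
  have hSsymm : ∀ ζ ξ, S ζ ξ = S ξ ζ := fun ζ ξ => by
    have hsymm : IsSymmSndFDerivAt ℝ F v := hFv.isSymmSndFDerivAt (by simp)
    simp only [hS]
    rw [hsymm.eq ζ ξ, hA.1 v hv ζ ξ, hA'.1 (F v) (hmaps hv) (fderiv ℝ F v ζ)]
  have hzero := eq_zero_of_symm_of_antisymm
    (T := fun ζ ξ η => g' (F v) (S ζ ξ) (fderiv ℝ F v η))
    (fun ζ ξ η => by simp only [hSsymm ζ ξ])
    (fun ζ ξ η => by
      have h1 := hderiv ζ ξ η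
      have h2 := hg'.1 (F v) (hmaps hv) (fderiv ℝ F v ξ)
      rw [h2, h2, ← hpol v hv, ← hpol v hv, h2] at h1
      simp only [hS, map_add, map_sub, add_apply,
        sub_apply]
      linarith)
  obtain ⟨η, hη⟩ := hsurj v hv (S ζ ξ)
  have hSz : S ζ ξ = 0 := by
    by_contra hne
    have h1 := hzero ζ ξ η
    simp only [hη] at h1
    exact (hg'.2 (F v) (hmaps hv) _ hne).ne' h1
  rw [eq_sub_iff_add_eq]
  exact sub_eq_zero.1 hSz

end LeviCivita

/-- If the metrics `g` on `Ω` and `g'` on `Ω'` admit Levi-Civita connection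
forms of class `C^k`, then every `C²` isometry `F : Ω → Ω'` (a `C²` diffeomorphism onto an open
subset of `Ω'`, with inverse `G`) is automatically `C^{k+2}`. -/
theorem statement10 {V V' : Type*} [NormedAddCommGroup V] [NormedSpace ℝ V]
    [NormedAddCommGroup V'] [NormedSpace ℝ V']
    (Ω : Set V) (hΩ : IsOpen Ω) (Ω' : Set V') (hΩ' : IsOpen Ω')
    (g : V → V →L[ℝ] V →L[ℝ] ℝ) (hg : IsRiemannianMetric Ω g)
    (g' : V' → V' →L[ℝ] V' →L[ℝ] ℝ) (hg' : IsRiemannianMetric Ω' g')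
    (k : ℕ)
    (A : V → V →L[ℝ] V →L[ℝ] V) (hAk : ContDiffOn ℝ k A Ω) (hALC : IsLeviCivita Ω g A)
    (A' : V' → V' →L[ℝ] V' →L[ℝ] V') (hA'k : ContDiffOn ℝ k A' Ω')
    (hA'LC : IsLeviCivita Ω' g' A')
    (F : V → V') (G : V' → V)
    (hF : ContDiffOn ℝ 2 F Ω) (him : F '' Ω ⊆ Ω') (hopen : IsOpen (F '' Ω))
    (hG : ContDiffOn ℝ 2 G (F '' Ω)) (hGF : ∀ v ∈ Ω, G (F v) = v)
    (hiso : ∀ v ∈ Ω, ∀ ξ : V,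
      g' (F v) (fderiv ℝ F v ξ) (fderiv ℝ F v ξ) = g v ξ ξ) :
    ContDiffOn ℝ (k + 2 : ℕ∞) F Ω := by
  have hmaps : Set.MapsTo F Ω Ω' := fun v hv => him ⟨v, hv, rfl⟩
  have hsurj : ∀ v ∈ Ω, Function.Surjective (fderiv ℝ F v) := by
    intro v hv y
    have hFv : F v ∈ F '' Ω := ⟨v, hv, rfl⟩
    have hFd : HasFDerivAt F (fderiv ℝ F v) (G (F v)) := by
      rw [hGF v hv]
      exact ((hF.contDiffAt (hΩ.mem_nhds hv)).differentiableAt (by norm_num)).hasFDerivAt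
    have hGd : HasFDerivAt G (fderiv ℝ G (F v)) (F v) :=
      ((hG.contDiffAt (hopen.mem_nhds hFv)).differentiableAt (by norm_num)).hasFDerivAt
    have hid : F ∘ G =ᶠ[𝓝 (F v)] id := by
      filter_upwards [hopen.mem_nhds hFv]
      rintro _ ⟨w, hw, rfl⟩
      simp [hGF w hw]
    have h := (hFd.comp _ hGd).unique ((hasFDerivAt_id _).congr_of_eventuallyEq hid)
    exact ⟨fderiv ℝ G (F v) y, by simpa using congrArg (fun L => L y) h⟩
  have hD2 : ∀ v ∈ Ω, fderiv ℝ (fderiv ℝ F) v =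
      (ContinuousLinearMap.compL ℝ V V V' (fderiv ℝ F v)).comp (A v) -
      (((ContinuousLinearMap.compL ℝ V V' V').flip (fderiv ℝ F v)).comp (A' (F v))).comp
        (fderiv ℝ F v) := by
    intro v hv
    ext ζ ξ
    simpa using hALC.fderiv_fderiv_isometry hΩ hΩ' hg hg' hA'k.continuousOn hA'LC hF hmaps hsurj
      hiso hv ζ ξ
  have step : ∀ j : ℕ, j ≤ k → ContDiffOn ℝ ((j : WithTop ℕ∞) + 1 + 1) F Ω := by
    intro j
    induction j with
    | zero => intro _; exact hF.of_le (by norm_num)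
    | succ j ih =>
      intro hj
      have hFj := ih (by omega)
      have hle : (j : WithTop ℕ∞) + 1 ≤ k := by exact_mod_cast hj
      have hDF : ContDiffOn ℝ ((j : WithTop ℕ∞) + 1) (fderiv ℝ F) Ω :=
        hFj.fderiv_of_isOpen hΩ le_rfl
      have hDDF : ContDiffOn ℝ ((j : WithTop ℕ∞) + 1) (fderiv ℝ (fderiv ℝ F)) Ω := by
        refine ContDiffOn.congr ?_ hD2
        have hA'F : ContDiffOn ℝ ((j : WithTop ℕ∞) + 1) (fun v => A' (F v)) Ω :=
          (hA'k.of_le hle).comp (hFj.of_le le_self_add) hmaps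
        refine ContDiffOn.sub (ContDiffOn.clm_comp ?_ (hAk.of_le hle))
          (ContDiffOn.clm_comp (ContDiffOn.clm_comp ?_ hA'F) hDF)
        · exact (ContinuousLinearMap.contDiff _).comp_contDiffOn hDF
        · exact (ContinuousLinearMap.contDiff _).comp_contDiffOn hDF
      push_cast
      refine (contDiffOn_succ_iff_fderiv_of_isOpen hΩ).2
        ⟨hF.differentiableOn (by norm_num), by simp, ?_⟩
      refine (contDiffOn_succ_iff_fderiv_of_isOpen hΩ).2
        ⟨hDF.differentiableOn (by simp), by simp, hDDF⟩
  refine (step k le_rfl).of_le ?_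
  rw [add_assoc, one_add_one_eq_two]
  norm_cast
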